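/- Let n be a positive integer and let S and T be n×n real matrices that are both (column-)stochastic (all entries nonnegative, each column summing to 1). If S·T = I (the identity matrix), then S and T are permutation matrices (and T = S⁻¹). -/

import Mathlib

open Matrix

/-- A (column-)stochastic matrix: nonnegative entries, each column sums to 1. -/
def ColStochastic {n : ℕ} (S : Matrix (Fin n) (Fin n) ℝ) : Prop :=
  (∀ i j, 0 ≤ S i j) ∧ ∀ j, ∑ i, S i j = 1

/-- A permutation matrix. -/
def IsPermMatrix {n : ℕ} (S : Matrix (Fin n) (Fin n) ℝ) : Prop :=
  ∃ σ : Equiv.Perm (Fin n), ∀ i j, S i j = if i = σ j then 1 else 0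

/-- If the product of two stochastic matrices is the identity, then every standard basis vector
is a column of the left factor. -/
lemma ColStochastic.exists_col_eq_of_mul_eq_one {n : ℕ} {S T : Matrix (Fin n) (Fin n) ℝ}
    (hS : ColStochastic S) (hT : ColStochastic T) (h : S * T = 1) (j : Fin n) :
    ∃ k, ∀ i, S i k = if i = j then 1 else 0 := by
  obtain ⟨k, -, hk⟩ : ∃ k ∈ Finset.univ, T k j ≠ 0 :=
    Finset.exists_ne_zero_of_sum_ne_zero (by rw [hT.2 j]; exact one_ne_zero)
  have hzero : ∀ i, i ≠ j → S i k = 0 := by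
    intro i hij
    have hsum : ∑ l, S i l * T l j = 0 := by
      rw [← Matrix.mul_apply, h, Matrix.one_apply_ne hij]
    have hterm := (Finset.sum_eq_zero_iff_of_nonneg
      fun l _ => mul_nonneg (hS.1 i l) (hT.1 l j)).1 hsum k (Finset.mem_univ k)
    exact (mul_eq_zero.1 hterm).resolve_right hk
  refine ⟨k, fun i => ?_⟩
  split_ifs with hij
  · rw [hij, ← hS.2 k, Finset.sum_eq_single j (fun l _ hl => hzero l hl) (by simp)]
  · exact hzero i hij

/-- A stochastic matrix with a stochastic right inverse is a permutation matrix. -/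
lemma ColStochastic.isPermMatrix_of_mul_eq_one {n : ℕ} {S T : Matrix (Fin n) (Fin n) ℝ}
    (hS : ColStochastic S) (hT : ColStochastic T) (h : S * T = 1) : IsPermMatrix S := by
  choose τ hτ using hS.exists_col_eq_of_mul_eq_one hT h
  have hinj : Function.Injective τ := by
    intro a b hab
    by_contra hne
    have ha := hτ a a
    rw [hab, hτ b a] at ha
    simp [hne] at ha
  let e := Equiv.ofBijective τ (Finite.injective_iff_bijective.1 hinj)
  refine ⟨e.symm, fun i j => ?_⟩
  rw [← hτ (e.symm j) i]
  exact congrArg (S i) (e.apply_symm_apply j).symm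

/-- if S and T are stochastic and S·T = I, then S and T are
permutation matrices and T = S⁻¹ (i.e. also T·S = I). -/
theorem stochastic_inverse_is_permutation (n : ℕ) (hn : 0 < n)
    (S T : Matrix (Fin n) (Fin n) ℝ)
    (hS : ColStochastic S) (hT : ColStochastic T) (h : S * T = 1) :
    IsPermMatrix S ∧ IsPermMatrix T ∧ T * S = 1 := by
  have h' : T * S = 1 := mul_eq_one_comm.1 h
  exact ⟨hS.isPermMatrix_of_mul_eq_one hT h, hT.isPermMatrix_of_mul_eq_one hS h', h'⟩
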